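/- arXiv:2507.06977 — 3 statements merged into one kernel-verified Lean document; each statement's English description precedes it below -/
import Mathlib

section
/- Let I and I' be infinite structures in the same language whose ages coincide (i.e., the same finitely generated substructures occur in each, up to isomorphism). Then for any family (a_i)_{i∈I} of tuples in a structure M there exists a family (a'_j)_{j∈I'} in some elementary extension of M that is locally based on (a_i)_{i∈I}; and symmetrically, for any family (b_j)_{j∈I'} there exists a family (b'_i)_{i∈I} in some elementary extension locally based on it. -/
/- Common definitions for formalizing "Tree properties for colored linear orders". -/

open FirstOrder FirstOrder.Language Cardinal

universe u v

namespace PaperTP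

/-- Two tuples (possibly in two different structures of the same language) have the same
complete quantifier-free type. -/
def qfTypeEq (L' : FirstOrder.Language.{u, u}) {A : Type u} {B : Type u} [L'.Structure A] [L'.Structure B]
    {n : ℕ} (t : Fin n → A) (s : Fin n → B) : Prop :=
  ∀ φ : L'.Formula (Fin n), BoundedFormula.IsQF φ →
    (Formula.Realize φ t ↔ Formula.Realize φ s)

/-- An elementary extension of the `L`-structure `M`, bundled. -/
structure ElemExtension (L : FirstOrder.Language.{u, u}) (M : Type u) [L.Structure M] :
    Type (u + 1) where
  carrier : Type u
  str : L.Structure carrier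
  emb : @Language.ElementaryEmbedding L M carrier _ str

/-- A family of formulas `φs i (x, aₛ i)` (with parameters substituted for the `β`-variables) is
consistent: it is realized in some elementary extension of `M` (equivalently, it is finitely
satisfiable). -/
def Consistent {L : FirstOrder.Language.{u, u}} {M : Type u} [L.Structure M] {α β : Type} {ι : Type v}
    (φs : ι → L.Formula (α ⊕ β)) (as : ι → β → M) : Prop :=
  ∃ E : ElemExtension L M,
    letI := E.str
    ∃ x : α → E.carrier, ∀ i, Formula.Realize (φs i) (Sum.elim x fun j => E.emb.toFun (as i j))

/-- `(a i)_{i ∈ I}` is an `I`-indexed indiscernible family of `β`-tuples in `M`. -/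
def IndexedIndiscernible (L' : FirstOrder.Language.{u, u}) (I : Type u) [L'.Structure I]
    {L : FirstOrder.Language.{u, u}} {M : Type u} [L.Structure M] {β : Type} (a : I → β → M) : Prop :=
  ∀ (n : ℕ) (t s : Fin n → I), qfTypeEq L' t s →
    ∀ φ : L.Formula (Fin n × β),
      (Formula.Realize φ fun p => a (t p.1) p.2) ↔ Formula.Realize φ fun p => a (s p.1) p.2

/-- `(a i)_{i ∈ I}` is an `I`-indexed indiscernible family of `β`-tuples in `M`, over the
parameter set `Cset`. -/
def IndexedIndiscernibleOver (L' : FirstOrder.Language.{u, u}) (I : Type u) [L'.Structure I]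
    {L : FirstOrder.Language.{u, u}} {M : Type u} [L.Structure M] {β : Type}
    (Cset : Set M) (a : I → β → M) : Prop :=
  ∀ (n k : ℕ) (t s : Fin n → I) (c : Fin k → M), (∀ j, c j ∈ Cset) → qfTypeEq L' t s →
    ∀ φ : L.Formula (Fin n × β ⊕ Fin k),
      (Formula.Realize φ (Sum.elim (fun p => a (t p.1) p.2) c) ↔
        Formula.Realize φ (Sum.elim (fun p => a (s p.1) p.2) c))

/-- The family `(b j)_{j ∈ J}` (in `N`) is locally based on the family `(a i)_{i ∈ I}` (in `M`):
for every finite set `Δ` of formulas and finite tuple `t` of indices from `J` there is a tuple `s`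
of indices from `I` with the same complete quantifier-free type such that the `Δ`-types match. -/
def LocallyBased (L' : FirstOrder.Language.{u, u}) {J I : Type u} [L'.Structure J] [L'.Structure I]
    {L : FirstOrder.Language.{u, u}} {M N : Type u} [L.Structure M] [L.Structure N] {β : Type}
    (b : J → β → N) (a : I → β → M) : Prop :=
  ∀ (n : ℕ) (Δ : Set (L.Formula (Fin n × β))), Δ.Finite → ∀ t : Fin n → J,
    ∃ s : Fin n → I, qfTypeEq L' t s ∧
      ∀ φ ∈ Δ, ((Formula.Realize φ fun p => b (t p.1) p.2) ↔
        Formula.Realize φ fun p => a (s p.1) p.2)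

/-- `I`-indexed indiscernibles have the modeling property: every `I`-indexed family of tuples in
any structure `M` admits an `I`-indexed indiscernible family, in some elementary extension of `M`,
locally based on it. -/
def ModelingProperty (L' : FirstOrder.Language.{u, u}) (I : Type u) [L'.Structure I] : Prop :=
  ∀ (L : FirstOrder.Language.{u, u}) (M : Type u) (S : L.Structure M),
    letI := S
    ∀ (β : Type) (a : I → β → M),
      ∃ E : ElemExtension L M,
        letI := E.str
        ∃ b : I → β → E.carrier,
          IndexedIndiscernible (L := L) L' I b ∧
            LocallyBased (L := L) L' b fun i x => E.emb.toFun (a i x)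

/-- A Ramsey index structure: a locally finite structure with a relation symbol interpreted as a
linear (strict total) order, whose indexed indiscernibles have the modeling property. -/
def IsRamseyIndex (L' : FirstOrder.Language.{u, u}) (I : Type u) [L'.Structure I]
    (lt : L'.Relations 2) : Prop :=
  IsStrictTotalOrder I (fun a b => Structure.RelMap lt ![a, b]) ∧
  (∀ s : Set I, s.Finite →
    Set.Finite ((Substructure.closure L' s : L'.Substructure I) : Set I)) ∧
  ModelingProperty L' I

/-! ### Colored linear orders -/

/-- The language of `κ`-colored linear orders: a binary order relation and a unary predicate for
each color in `κ`. -/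
def colLang (κ : Type u) : FirstOrder.Language.{u, u} where
  Functions := fun _ => PEmpty
  Relations := fun n =>
    match n with
    | 1 => κ
    | 2 => PUnit
    | _ => PEmpty

/-- The order symbol of the colored linear order language. -/
def ltSym (κ : Type u) : (colLang κ).Relations 2 := PUnit.unit

/-- The color predicates of the colored linear order language. -/
def colSym {κ : Type u} (c : κ) : (colLang κ).Relations 1 := c

/-- The order of a structure in the colored linear order language. -/
def cLT (κ : Type u) {C : Type u} [(colLang κ).Structure C] (x y : C) : Prop :=
  Structure.RelMap (ltSym κ) ![x, y]

/-- `x` has color `c` in a structure for the colored linear order language. -/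
def HasColor (κ : Type u) {C : Type u} [(colLang κ).Structure C] (c : κ) (x : C) : Prop :=
  Structure.RelMap (colSym c) ![x]

/-- `C` is (up to isomorphism) the colored linear order `c_κ`, i.e. the Fraïssé limit of the class
of finite linear orders whose domain is partitioned into colors from `κ`: it is a countable,
ultrahomogeneous, colored linear order into which every finite `κ`-colored linear order embeds. -/
structure IsColoredLimit (κ C : Type u) [(colLang κ).Structure C] : Prop where
  strict : IsStrictTotalOrder C (cLT κ)
  partition : ∀ x : C, ∃! c : κ, HasColor κ c x
  countable : Countable C
  ageFull : ∀ (n : ℕ) (pat : Fin n → κ), ∃ f : Fin n → C,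
    (∀ i j : Fin n, i < j → cLT κ (f i) (f j)) ∧ ∀ i, HasColor κ (pat i) (f i)
  ultrahomogeneous : ∀ (n : ℕ) (s t : Fin n → C), qfTypeEq (colLang κ) s t →
    ∃ g : C ≃[colLang κ] C, ∀ i, g (s i) = t i

/-! ### Tree properties -/

/-- The family of formulas `φ (x, f i)`, indexed by `i ∈ C`, is `q`-inconsistent, where the
complete quantifier-free type `q` is represented by a tuple realizing it in `C`: whenever a tuple
`t` of indices realizes `q`, the corresponding finite set of formulas is inconsistent. -/
def QInconsistent (L' : FirstOrder.Language.{u, u}) {C : Type u} [L'.Structure C]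
    {L : FirstOrder.Language.{u, u}} {M : Type u} [L.Structure M] {α β : Type} {k : ℕ}
    (φ : L.Formula (α ⊕ β)) (q : Fin k → C) (f : C → β → M) : Prop :=
  ∀ t : Fin k → C, qfTypeEq L' q t →
    ¬ Consistent (fun _ : Fin k => φ) fun j => f (t j)

/-- `φ` has the `I`-tree property witnessed by the complete quantifier-free type of the tuple `q`:
there is a tree of parameters indexed by `I^{<ω}` all of whose branches are consistent and all of
whose families of immediate successors are `q`-inconsistent. -/
def HasITPWith (L' : FirstOrder.Language.{u, u}) (C : Type u) [L'.Structure C]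
    {L : FirstOrder.Language.{u, u}} {M : Type u} [L.Structure M] {α β : Type} {k : ℕ}
    (φ : L.Formula (α ⊕ β)) (q : Fin k → C) : Prop :=
  ∃ a : List C → β → M,
    (∀ b : ℕ → C, Consistent (fun _ : ℕ => φ) fun n => a (List.ofFn fun i : Fin n => b i)) ∧
    (∀ η : List C, QInconsistent L' φ q fun i => a (η ++ [i]))

/-- `φ` has the `I`-tree property (`I`-TP), for the index structure `C`. -/
def HasITP (L' : FirstOrder.Language.{u, u}) (C : Type u) [L'.Structure C]
    {L : FirstOrder.Language.{u, u}} {M : Type u} [L.Structure M] {α β : Type}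
    (φ : L.Formula (α ⊕ β)) : Prop :=
  ∃ (k : ℕ) (q : Fin k → C), HasITPWith L' C (M := M) φ q

/-- `φ` has `I`-TP₂ witnessed by the complete quantifier-free type of the tuple `q`: there is an
array of parameters, with rows indexed by `C`, such that all paths are consistent while every row
is `q`-inconsistent. -/
def HasITP2With (L' : FirstOrder.Language.{u, u}) (C : Type u) [L'.Structure C]
    {L : FirstOrder.Language.{u, u}} {M : Type u} [L.Structure M] {α β : Type} {k : ℕ}
    (φ : L.Formula (α ⊕ β)) (q : Fin k → C) : Prop :=
  ∃ a : ℕ → C → β → M,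
    (∀ f : ℕ → C, Consistent (fun _ : ℕ => φ) fun i => a i (f i)) ∧
    (∀ i : ℕ, QInconsistent L' φ q (a i))

/-- `φ` has `I`-TP₂, for the index structure `C`. -/
def HasITP2 (L' : FirstOrder.Language.{u, u}) (C : Type u) [L'.Structure C]
    {L : FirstOrder.Language.{u, u}} {M : Type u} [L.Structure M] {α β : Type}
    (φ : L.Formula (α ⊕ β)) : Prop :=
  ∃ (k : ℕ) (q : Fin k → C), HasITP2With L' C (M := M) φ q

/-- The classical tree property: a tree of parameters indexed by `ω^{<ω}` with consistent branches
and `k`-inconsistent siblings. -/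
def HasTP {L : FirstOrder.Language.{u, u}} {M : Type u} [L.Structure M] {α β : Type}
    (φ : L.Formula (α ⊕ β)) : Prop :=
  ∃ (a : List ℕ → β → M) (k : ℕ), 0 < k ∧
    (∀ b : ℕ → ℕ, Consistent (fun _ : ℕ => φ) fun n => a (List.ofFn fun i : Fin n => b i)) ∧
    (∀ (η : List ℕ) (t : Fin k → ℕ), Function.Injective t →
      ¬ Consistent (fun _ : Fin k => φ) fun j => a (η ++ [t j]))

/-- The classical tree property of the first kind (TP₁): a tree of parameters indexed by `ω^{<ω}`
in which all initial segments of nodes are consistent and any `k` pairwise incomparable nodes are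
inconsistent. -/
def HasTP1 {L : FirstOrder.Language.{u, u}} {M : Type u} [L.Structure M] {α β : Type}
    (φ : L.Formula (α ⊕ β)) : Prop :=
  ∃ (a : List ℕ → β → M) (k : ℕ), 0 < k ∧
    (∀ η : List ℕ, Consistent (fun i : Fin (η.length + 1) => φ) fun i => a (η.take i)) ∧
    (∀ t : Fin k → List ℕ, (∀ i j, i ≠ j → ¬ t i <+: t j) →
      ¬ Consistent (fun _ : Fin k => φ) fun j => a (t j))

/-- The conjunction `ψ (x; y₀, …, y_{c-1}) = ⋀_{i<c} φ (x, yᵢ)` of `c` instances of `φ` has TP₁;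
the parameters of `ψ` are organized as `c`-tuples of `β`-tuples. -/
def ConjHasTP1 {L : FirstOrder.Language.{u, u}} {M : Type u} [L.Structure M] {α β : Type}
    (φ : L.Formula (α ⊕ β)) (c : ℕ) : Prop :=
  ∃ (a : List ℕ → Fin c → β → M) (k : ℕ), 0 < k ∧
    (∀ η : List ℕ, Consistent (fun p : Fin (η.length + 1) × Fin c => φ)
      fun p => a (η.take p.1) p.2) ∧
    (∀ t : Fin k → List ℕ, (∀ i j, i ≠ j → ¬ t i <+: t j) →
      ¬ Consistent (fun _ : Fin k × Fin c => φ) fun p => a (t p.1) p.2)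

/-- The structure, in the language of `κ`-colored linear orders, on the tree of nodes `C^{<ω}`:
nodes are compared in the lexicographic order of the tree, and each node (other than the root)
carries the color of its last entry. -/
def nodeStructure (κ C : Type u) [(colLang κ).Structure C] :
    (colLang κ).Structure (List C) where
  funMap := fun {n} f _ => PEmpty.elim f
  RelMap := fun {n} =>
    match n with
    | 0 => fun r _ => PEmpty.elim r
    | 1 => fun c x => ∃ (η : List C) (i : C), x 0 = η ++ [i] ∧ HasColor κ c i
    | 2 => fun _ x => List.Lex (cLT κ) (x 0) (x 1)
    | (_ + 3) => fun r _ => PEmpty.elim r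

/-- `φ` has c-TP₁ witnessed by the complete quantifier-free type of the tuple `q` from the colored
linear order `C`: there is a tree of parameters indexed by `C^{<ω}` in which all initial segments
of nodes are consistent, while any pairwise incomparable nodes whose quantifier-free type in the
language of `C` (nodes carrying the colors of their last entries, ordered lexicographically) is
`q` are inconsistent. -/
def HasCTP1With (κ C : Type u) [(colLang κ).Structure C]
    {L : FirstOrder.Language.{u, u}} {M : Type u} [L.Structure M] {α β : Type} {k : ℕ}
    (φ : L.Formula (α ⊕ β)) (q : Fin k → C) : Prop :=
  ∃ a : List C → β → M,
    (∀ η : List C, Consistent (fun i : Fin (η.length + 1) => φ) fun i => a (η.take i)) ∧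
    (∀ t : Fin k → List C, (∀ i j, i ≠ j → ¬ t i <+: t j) →
      (letI := nodeStructure κ C; qfTypeEq (colLang κ) q t) →
      ¬ Consistent (fun _ : Fin k => φ) fun j => a (t j))

/-- `φ` has c-TP₁, for the colored linear order `C`. -/
def HasCTP1 (κ C : Type u) [(colLang κ).Structure C]
    {L : FirstOrder.Language.{u, u}} {M : Type u} [L.Structure M] {α β : Type}
    (φ : L.Formula (α ⊕ β)) : Prop :=
  ∃ (k : ℕ) (q : Fin k → C), HasCTP1With κ C (M := M) φ q

/-! ### Stability, IP, and order indiscernibles -/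

/-- `φ (x, y)` is unstable (has the order property). -/
def HasOrderProperty {L : FirstOrder.Language.{u, u}} {M : Type u} [L.Structure M] {α β : Type}
    (φ : L.Formula (α ⊕ β)) : Prop :=
  ∃ (a : ℕ → α → M) (b : ℕ → β → M),
    ∀ i j : ℕ, Formula.Realize φ (Sum.elim (a i) (b j)) ↔ i < j

/-- `(a i)_{i<ω}` is an indiscernible sequence of `γ`-tuples. -/
def OrderIndiscernible {L : FirstOrder.Language.{u, u}} {M : Type u} [L.Structure M] {γ : Type}
    (a : ℕ → γ → M) : Prop :=
  ∀ (n : ℕ) (t s : Fin n → ℕ), StrictMono t → StrictMono s →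
    ∀ φ : L.Formula (Fin n × γ),
      (Formula.Realize φ fun p => a (t p.1) p.2) ↔ Formula.Realize φ fun p => a (s p.1) p.2

/-- `φ (x, y)` has the independence property: there is an indiscernible sequence `(a i)` such that
`{φ (x, aᵢ) : i even} ∪ {¬ φ (x, aᵢ) : i odd}` is consistent. -/
def HasIP {L : FirstOrder.Language.{u, u}} {M : Type u} [L.Structure M] {α β : Type}
    (φ : L.Formula (α ⊕ β)) : Prop :=
  ∃ a : ℕ → β → M, OrderIndiscernible (L := L) a ∧
    ∃ E : ElemExtension L M,
      letI := E.str
      ∃ x : α → E.carrier, ∀ i : ℕ,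
        (Even i → Formula.Realize φ (Sum.elim x fun j => E.emb.toFun (a i j))) ∧
        (¬ Even i → ¬ Formula.Realize φ (Sum.elim x fun j => E.emb.toFun (a i j)))

/-- The conjunction `ψ (x; y₀, …, y_{c-1}) = ⋀_{i<c} φ (x, yᵢ)` of `c` instances of `φ` has the
independence property; the parameters of `ψ` are organized as `c`-tuples of `β`-tuples. -/
def ConjHasIP {L : FirstOrder.Language.{u, u}} {M : Type u} [L.Structure M] {α β : Type}
    (φ : L.Formula (α ⊕ β)) (c : ℕ) : Prop :=
  ∃ a : ℕ → Fin c → β → M, OrderIndiscernible (L := L) (fun i (p : Fin c × β) => a i p.1 p.2) ∧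
    ∃ E : ElemExtension L M,
      letI := E.str
      ∃ x : α → E.carrier, ∀ i : ℕ,
        (Even i → ∀ m : Fin c, Formula.Realize φ (Sum.elim x fun j => E.emb.toFun (a i m j))) ∧
        (¬ Even i → ∃ m : Fin c, ¬ Formula.Realize φ (Sum.elim x fun j => E.emb.toFun (a i m j)))

/-! ### Generalized dividing and local character -/

/-- `φ (x, c)` `I`-divides over the set `B`: there is an `I`-indexed family of tuples,
indiscernible over `B`, containing `c`, such that the corresponding family of instances of `φ`
is inconsistent. -/
def FormulaDividesOver (L' : FirstOrder.Language.{u, u}) (C : Type u) [L'.Structure C]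
    {L : FirstOrder.Language.{u, u}} {M : Type u} [L.Structure M] {α β : Type}
    (φ : L.Formula (α ⊕ β)) (c : β → M) (B : Set M) : Prop :=
  ∃ (f : C → β → M) (j₀ : C), IndexedIndiscernibleOver (L := L) L' C B f ∧ f j₀ = c ∧
    ¬ Consistent (fun _ : C => φ) f

/-- `(a i)` is a `q`-inconsistent `I`-dividing chain for `φ`: the instances `φ (x, a i)` are
jointly consistent, and each `φ (x, a i)` `I`-divides over the earlier elements of the chain,
witnessed by an indiscernible family that is `q`-inconsistent for the single fixed complete
quantifier-free type represented by the tuple `q`. -/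
def QIncDividingChain (L' : FirstOrder.Language.{u, u}) (C : Type u) [L'.Structure C]
    {L : FirstOrder.Language.{u, u}} {M : Type u} [L.Structure M] {α β : Type}
    (φ : L.Formula (α ⊕ β)) {k : ℕ} (q : Fin k → C) {J : Type v} [LinearOrder J]
    (a : J → β → M) : Prop :=
  Consistent (fun _ : J => φ) a ∧
  ∀ i : J, ∃ (f : C → β → M) (j₀ : C),
    IndexedIndiscernibleOver (L := L) L' C {m : M | ∃ j x, j < i ∧ m = a j x} f ∧
    f j₀ = a i ∧ QInconsistent L' φ q f ∧ ¬ Consistent (fun _ : C => φ) f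

/-- `p` is a complete type over `A` in the variables `α`, presented as a set of formulas paired
with their parameter tuples: all parameters come from `A`, `p` is finitely satisfiable, and `p`
decides every formula with parameters in `A`. -/
def IsCompleteTypeOver (L : FirstOrder.Language.{u, u}) (M : Type u) [L.Structure M] (A : Set M)
    (α : Type) (p : Set (Σ k : ℕ, L.Formula (α ⊕ Fin k) × (Fin k → M))) : Prop :=
  (∀ ψ ∈ p, ∀ j, ψ.2.2 j ∈ A) ∧
  (∀ S ⊆ p, S.Finite →
    ∃ E : ElemExtension L M,
      letI := E.str
      ∃ x : α → E.carrier, ∀ ψ ∈ S,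
        Formula.Realize ψ.2.1 (Sum.elim x fun j => E.emb.toFun (ψ.2.2 j))) ∧
  (∀ (k : ℕ) (φ : L.Formula (α ⊕ Fin k)) (c : Fin k → M), (∀ j, c j ∈ A) →
    (⟨k, φ, c⟩ ∈ p ∨ ⟨k, BoundedFormula.not φ, c⟩ ∈ p))

/-- The type `p` `I`-divides over the set `B` if some formula in it does. -/
def TypeDividesOver (L' : FirstOrder.Language.{u, u}) (C : Type u) [L'.Structure C]
    {L : FirstOrder.Language.{u, u}} {M : Type u} [L.Structure M] {α : Type}
    (p : Set (Σ k : ℕ, L.Formula (α ⊕ Fin k) × (Fin k → M))) (B : Set M) : Prop :=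
  ∃ ψ ∈ p, FormulaDividesOver L' C ψ.2.1 ψ.2.2 B

/-- Equality of complete quantifier-free types is an equivalence relation on `n`-tuples. -/
def qfSetoid (L' : FirstOrder.Language.{u, u}) (C : Type u) [L'.Structure C] (n : ℕ) :
    Setoid (Fin n → C) :=
  ⟨fun t s => qfTypeEq L' t s,
    fun _ _ _ => Iff.rfl,
    fun h φ hφ => (h φ hφ).symm,
    fun h₁ h₂ φ hφ => (h₁ φ hφ).trans (h₂ φ hφ)⟩

/-- The number of complete quantifier-free types of `C` in finitely many variables. -/
def numQfTypes (L' : FirstOrder.Language.{u, u}) (C : Type u) [L'.Structure C] : Cardinal.{u} :=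
  #(Σ n : ℕ, Quotient (qfSetoid L' C n))

/-- `I`-dividing has local character (for the complete theory of `M`): every complete type over
any set `A` fails to `I`-divide over some subset of `A` of size at most `|T| + κ`, where `κ` is
the number of complete quantifier-free types of the index structure in finitely many variables. -/
def LocalChar (L : FirstOrder.Language.{u, u}) (M : Type u) [L.Structure M]
    (L' : FirstOrder.Language.{u, u}) (C : Type u) [L'.Structure C] : Prop :=
  ∀ (α : Type) (A : Set M) (p : Set (Σ k : ℕ, L.Formula (α ⊕ Fin k) × (Fin k → M))),
    IsCompleteTypeOver L M A α p →
    ∃ B : Set M, B ⊆ A ∧ #B ≤ Language.card L + ℵ₀ + numQfTypes L' C ∧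
      ¬ TypeDividesOver L' C p B

/-! ### Monster models -/

/-- `M` is `κ̄`-saturated: every finitely satisfiable family of formulas whose parameters form a
set of size `< κ̄` is realized in `M`. -/
def Saturated (L : FirstOrder.Language.{u, u}) (M : Type u) [L.Structure M]
    (κbar : Cardinal.{u}) : Prop :=
  ∀ (α : Type) (ι : Type u) (ks : ι → ℕ) (φs : ∀ i, L.Formula (α ⊕ Fin (ks i)))
    (as : ∀ i, Fin (ks i) → M),
    #(⋃ i, Set.range (as i)) < κbar →
    (∀ s : Set ι, s.Finite → ∃ x : α → M, ∀ i ∈ s, Formula.Realize (φs i) (Sum.elim x (as i))) →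
    ∃ x : α → M, ∀ i, Formula.Realize (φs i) (Sum.elim x (as i))

/-- `M` is a monster model (relative to the bound `κ̄`): it is infinite, `κ̄`-saturated, and `κ̄`
is an uncountable strong limit. -/
def IsMonster (L : FirstOrder.Language.{u, u}) (M : Type u) [L.Structure M]
    (κbar : Cardinal.{u}) : Prop :=
  Infinite M ∧ Saturated L M κbar ∧ ℵ₀ < κbar ∧
    ∀ μ : Cardinal.{u}, μ < κbar → 2 ^ μ < κbar

/-! ### Maps between colored linear order languages -/

/-- Two tuples in structures of two different languages related by a language morphism have
corresponding quantifier-free types. -/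
def qfTypeEqAlong {L₁ L₂ : FirstOrder.Language.{u, u}} (Φ : L₁ →ᴸ L₂) {A B : Type u}
    [L₁.Structure A] [L₂.Structure B] {n : ℕ} (t : Fin n → A) (s : Fin n → B) : Prop :=
  ∀ φ : L₁.Formula (Fin n), BoundedFormula.IsQF φ →
    (Formula.Realize φ t ↔ Formula.Realize (LHom.onFormula Φ φ) s)

/-- The morphism of colored linear order languages induced by a map of colors. -/
def colMap {σ τ : Type u} (i : σ → τ) : colLang σ →ᴸ colLang τ where
  onFunction := fun {_} f => PEmpty.elim f
  onRelation := fun {n} =>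
    match n with
    | 0 => fun r => PEmpty.elim r
    | 1 => fun c => i c
    | 2 => fun r => r
    | (_ + 3) => fun r => PEmpty.elim r

/-! ### Generalized tree and array index structures -/

/-- The relational version `L'ᵣ` of a language `L'`: every `n`-ary function symbol is replaced by
an `(n+1)`-ary relation symbol. -/
def relationalize (L' : FirstOrder.Language.{u, u}) : FirstOrder.Language.{u, u} where
  Functions := fun _ => PEmpty
  Relations := fun n =>
    match n with
    | 0 => L'.Relations 0
    | (m + 1) => L'.Relations (m + 1) ⊕ L'.Functions m

/-- Interpret the relationalized language `L'ᵣ` on a type `A` that contains disjoint copies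
`emb b : I → A` of the `L'`-structure `I`: relations (and graphs of functions) hold only within a
single copy, where they are computed in `I`. -/
def relationalizeStructure (L' : FirstOrder.Language.{u, u}) {I A B : Type u} [L'.Structure I]
    (emb : B → I → A) : (relationalize L').Structure A where
  funMap := fun {_} f _ => PEmpty.elim f
  RelMap := fun {n} =>
    match n with
    | 0 => fun r _ => Structure.RelMap (L := L') (M := I) r fun j : Fin 0 => j.elim0
    | (m + 1) => fun r x =>
      match r with
      | Sum.inl r => ∃ (b : B) (ids : Fin (m + 1) → I),
          (∀ j, x j = emb b (ids j)) ∧ Structure.RelMap (M := I) r ids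
      | Sum.inr f => ∃ (b : B) (ids : Fin (m + 1) → I),
          (∀ j, x j = emb b (ids j)) ∧
            Structure.funMap (M := I) f (fun j : Fin m => ids j.castSucc) = ids (Fin.last m)

/-- The base language of trees: the tree partial order `⊴`, the lexicographic order `<ₗₑₓ`, and
the binary meet function `∧`. -/
def treeBase : FirstOrder.Language.{u, u} where
  Functions := fun n =>
    match n with
    | 2 => PUnit.{u + 1}
    | _ => PEmpty.{u + 1}
  Relations := fun n =>
    match n with
    | 2 => (PUnit.{u + 1} ⊕ PUnit.{u + 1} : Type u)
    | _ => PEmpty.{u + 1}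

/-- The longest common prefix (meet) of two finite sequences. -/
noncomputable def lcp {I : Type u} : List I → List I → List I
  | a :: as, b :: bs => if Classical.propDecidable (a = b) |>.decide then a :: lcp as bs else []
  | _, _ => []

/-- The base tree structure on `I^{<ω}`: `⊴` is the prefix (tree) order, `<ₗₑₓ` the lexicographic
order induced by the order `r` on `I`, and `∧` the longest common prefix. -/
noncomputable def treeBaseStructure (I : Type u) (r : I → I → Prop) :
    treeBase.Structure (List I) where
  funMap := fun {n} f x =>
    match n, f with
    | 0, f => PEmpty.elim f
    | 1, f => PEmpty.elim f
    | 2, _ => lcp (x 0) (x 1)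
    | (_ + 3), f => PEmpty.elim f
  RelMap := fun {n} R x =>
    match n, R with
    | 0, R => PEmpty.elim R
    | 1, R => PEmpty.elim R
    | 2, Sum.inl _ => x 0 <+: x 1
    | 2, Sum.inr _ => List.Lex r (x 0) (x 1)
    | (_ + 3), R => PEmpty.elim R

/-- The language of level predicates `P_α` for `α < ω`. -/
def levelLang : FirstOrder.Language.{u, u} where
  Functions := fun _ => PEmpty
  Relations := fun n =>
    match n with
    | 1 => ULift ℕ
    | _ => PEmpty

/-- The interpretation of the level predicates on a tree `I^{<ω}`: `P_α` holds of exactly the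
nodes of length `α`. -/
def levelStructure (I : Type u) : levelLang.Structure (List I) where
  funMap := fun {_} f _ => PEmpty.elim f
  RelMap := fun {n} R x =>
    match n, R with
    | 1, m => (x 0).length = m.down

/-- The language `L_{0,I}` for trees over the index structure `I`. -/
def treeLang0 (L' : FirstOrder.Language.{u, u}) : FirstOrder.Language.{u, u} :=
  treeBase.sum (relationalize L')

/-- The language `L_{s,ω,I}` for trees of height `ω` over the index structure `I`. -/
def treeLangS (L' : FirstOrder.Language.{u, u}) : FirstOrder.Language.{u, u} :=
  (treeLang0 L').sum levelLang

/-- The `L_{0,I}`-structure on the tree `I^{<ω}`, where the set of immediate successors of any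
node is a copy of `I`. -/
noncomputable def treeStructure0 (L' : FirstOrder.Language.{u, u}) (I : Type u) [L'.Structure I]
    (lt : L'.Relations 2) : (treeLang0 L').Structure (List I) :=
  letI := treeBaseStructure I fun a b => Structure.RelMap lt ![a, b]
  letI := relationalizeStructure L' fun (η : List I) (i : I) => η ++ [i]
  inferInstanceAs ((treeBase.sum (relationalize L')).Structure (List I))

/-- The `L_{s,ω,I}`-structure on the tree `I^{<ω}`. -/
noncomputable def treeStructureS (L' : FirstOrder.Language.{u, u}) (I : Type u) [L'.Structure I]
    (lt : L'.Relations 2) : (treeLangS L').Structure (List I) :=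
  letI := treeStructure0 L' I lt
  letI := levelStructure I
  inferInstanceAs (((treeLang0 L').sum levelLang).Structure (List I))

/-- The base language of arrays: a linear order and an equivalence relation. -/
def arrayBase : FirstOrder.Language.{u, u} where
  Functions := fun _ => PEmpty
  Relations := fun n =>
    match n with
    | 2 => (PUnit.{u + 1} ⊕ PUnit.{u + 1} : Type u)
    | _ => PEmpty.{u + 1}

/-- The convexly ordered equivalence relation on `K × I` whose classes are the rows
`{α} × I`. -/
def arrayBaseStructure (K I : Type u) [LinearOrder K] (r : I → I → Prop) :
    arrayBase.Structure (K × I) where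
  funMap := fun {_} f _ => PEmpty.elim f
  RelMap := fun {n} R x =>
    match n, R with
    | 0, R => PEmpty.elim R
    | 1, R => PEmpty.elim R
    | 2, Sum.inl _ => (x 0).1 < (x 1).1 ∨ ((x 0).1 = (x 1).1 ∧ r (x 0).2 (x 1).2)
    | 2, Sum.inr _ => (x 0).1 = (x 1).1
    | (_ + 3), R => PEmpty.elim R

/-- The language of `I`-arrays: a convexly ordered equivalence relation together with the
relational version of the language of `I`. -/
def arrayLang (L' : FirstOrder.Language.{u, u}) : FirstOrder.Language.{u, u} :=
  arrayBase.sum (relationalize L')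

/-- The structure of a convexly ordered equivalence relation on `K × I` whose classes are the
copies `{α} × I` of `I` (with functions of `I` replaced by their graphs on each copy). -/
def arrayStructure (L' : FirstOrder.Language.{u, u}) (K I : Type u) [LinearOrder K]
    [L'.Structure I] (lt : L'.Relations 2) : (arrayLang L').Structure (K × I) :=
  letI := arrayBaseStructure K I fun a b => Structure.RelMap lt ![a, b]
  letI := relationalizeStructure L' fun (k : K) (i : I) => (k, i)
  inferInstanceAs ((arrayBase.sum (relationalize L')).Structure (K × I))

/-- A `K × I`-array of tuples is mutually `I`-indiscernible: each row is an `I`-indexed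
indiscernible family over the entries of all the other rows. -/
def MutuallyIndiscernible (L' : FirstOrder.Language.{u, u}) (I : Type u) [L'.Structure I]
    {L : FirstOrder.Language.{u, u}} {M : Type u} [L.Structure M] {K : Type u} {β : Type}
    (a : K → I → β → M) : Prop :=
  ∀ i : K, IndexedIndiscernibleOver (L := L) L' I
    {m : M | ∃ k j x, k ≠ i ∧ m = a k j x} (a i)

/-- A `K × I`-array of tuples is strongly `I`-indiscernible: it is mutually `I`-indiscernible and
the sequence of its rows is an indiscernible sequence. -/
def StronglyIndiscernibleArray (L' : FirstOrder.Language.{u, u}) (I : Type u) [L'.Structure I]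
    {L : FirstOrder.Language.{u, u}} {M : Type u} [L.Structure M] {K : Type u} [LinearOrder K]
    {β : Type} (a : K → I → β → M) : Prop :=
  MutuallyIndiscernible (L := L) L' I a ∧
  ∀ (n : ℕ) (t s : Fin n → K), StrictMono t → StrictMono s →
    ∀ φ : L.Formula (Fin n × (I × β)),
      ((Formula.Realize φ fun p => a (t p.1) p.2.1 p.2.2) ↔
        Formula.Realize φ fun p => a (s p.1) p.2.1 p.2.2)


/-- Quantifier-free types are preserved when a finite subset of `J` is mapped into `I` by an
embedding of the generated substructure. -/
theorem exists_local_map (L' : FirstOrder.Language.{u, u}) (I J : Type u)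
    [L'.Structure I] [L'.Structure J] (hI : Infinite I)
    (hage : L'.age J ⊆ L'.age I) (F : Finset J) :
    ∃ g : J → I, ∀ (n : ℕ) (t : Fin n → J), (∀ k, t k ∈ F) →
      qfTypeEq L' t (fun k => g (t k)) := by
  classical
  have hfg : (Substructure.closure L' (F : Set J)).FG := Substructure.fg_closure F.finite_toSet
  have hmem : (CategoryTheory.Bundled.of (Substructure.closure L' (F : Set J)) :
      CategoryTheory.Bundled.{u} L'.Structure) ∈ L'.age J :=
    ⟨(Substructure.fg_iff_structure_fg _).1 hfg, ⟨Substructure.subtype _⟩⟩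
  obtain ⟨-, ⟨e⟩⟩ := hage hmem
  let e' : (Substructure.closure L' (F : Set J)) ↪[L'] I := e
  let g : J → I := fun j =>
    if h : j ∈ Substructure.closure L' (F : Set J) then e' ⟨j, h⟩ else Classical.arbitrary I
  refine ⟨g, fun n t ht φ hφ => ?_⟩
  have ht' : ∀ k, t k ∈ Substructure.closure L' (F : Set J) :=
    fun k => Substructure.subset_closure (ht k)
  let t' : Fin n → Substructure.closure L' (F : Set J) := fun k => ⟨t k, ht' k⟩
  have h1 : t = (Substructure.subtype (Substructure.closure L' (F : Set J))) ∘ t' := rfl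
  have h2 : (fun k => g (t k)) = e' ∘ t' := by
    funext k
    simp only [g, dif_pos (ht' k), t', Function.comp]
  have key : ∀ {B : Type u} [L'.Structure B]
      (f : (Substructure.closure L' (F : Set J)) ↪[L'] B),
      Formula.Realize φ t' ↔ Formula.Realize φ (f ∘ t') := by
    intro B _ f
    have h := hφ.realize_embedding f (v := t') (xs := default)
    unfold Formula.Realize
    rw [← h]
    exact iff_of_eq (congrArg _ (Subsingleton.elim _ _))
  rw [h2]
  conv_lhs => rw [h1]
  rw [← key, ← key]

/-- One direction of the transfer between index structures. -/
theorem exists_locallyBased (L' : FirstOrder.Language.{u, u}) (I J : Type u)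
    [L'.Structure I] [L'.Structure J] (hI : Infinite I)
    (hage : L'.age J ⊆ L'.age I)
    (L : FirstOrder.Language.{u, u}) (M : Type u) [L.Structure M] (β : Type) (a : I → β → M) :
    ∃ E : ElemExtension L M,
      letI := E.str
      ∃ b : J → β → E.carrier,
        LocallyBased (L := L) L' b fun i x => E.emb.toFun (a i x) := by
  classical
  choose g hg using exists_local_map L' I J hI hage
  rcases isEmpty_or_nonempty M with hM | hM
  · have hβ : IsEmpty β := ⟨fun x => hM.elim (a (Classical.arbitrary I) x)⟩
    refine ⟨⟨M, inferInstance, ElementaryEmbedding.refl L M⟩, fun _ x => hβ.elim x, ?_⟩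
    intro n Δ _ t
    refine ⟨fun k => g (Finset.univ.image t) (t k), hg _ n t (fun k => by simp), ?_⟩
    intro φ _
    exact iff_of_eq (congrArg _ (funext fun p => hβ.elim p.2))
  · let U : Ultrafilter (Finset J) := Ultrafilter.of Filter.atTop
    have hU : (U : Filter (Finset J)) ≤ Filter.atTop := Ultrafilter.of_le _
    let P : Type u := (U : Filter (Finset J)).Product (fun _ => M)
    let c : (Finset J → M) → P := fun f => Quotient.mk _ f
    have los : ∀ {γ : Type} (φ : L.Formula γ) (x : γ → Finset J → M),
        Formula.Realize φ (fun i => c (x i)) ↔ ∀ᶠ F in (U : Filter (Finset J)),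
          φ.Realize (fun i => x i F) :=
      fun φ x => Ultraproduct.realize_formula_cast (M := fun _ => M) (u := U) φ x
    let em : M ↪ₑ[L] P :=
      { toFun := fun m => c (fun _ => m)
        map_formula' := by
          intro n φ x
          have := los φ (fun i _ => x i)
          rw [Filter.eventually_const] at this
          exact this }
    refine ⟨⟨P, inferInstance, em⟩, fun j x => c (fun F => a (g F j) x), ?_⟩
    intro n Δ hΔ t
    have hev : ∀ᶠ F in (U : Filter (Finset J)), ∀ φ ∈ Δ,
        ((Formula.Realize φ fun p : Fin n × β => c (fun F => a (g F (t p.1)) p.2)) ↔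
          Formula.Realize φ fun p : Fin n × β => a (g F (t p.1)) p.2) := by
      rw [Filter.eventually_all_finite hΔ]
      intro φ _
      have h := los φ (fun (p : Fin n × β) F => a (g F (t p.1)) p.2)
      by_cases hr : Formula.Realize φ fun p : Fin n × β => c (fun F => a (g F (t p.1)) p.2)
      · filter_upwards [h.1 hr] with F hF
        exact iff_of_true hr hF
      · have h' := (Ultrafilter.eventually_not (f := U)).2 (fun hh => hr (h.2 hh))
        filter_upwards [h'] with F hF
        exact iff_of_false hr hF
    have hev2 := hU (Filter.eventually_ge_atTop (Finset.univ.image t))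
    obtain ⟨F, hF, hsub⟩ := (hev.and hev2).exists
    refine ⟨fun k => g F (t k), hg F n t (fun k => hsub (by simp)), fun φ hφ => ?_⟩
    refine (hF φ hφ).trans ?_
    exact (em.map_formula φ (fun p : Fin n × β => a (g F (t p.1)) p.2)).symm

/-- If `I` and `I'` are infinite structures in the same language whose ages
coincide, then for any family `(a_i)_{i ∈ I}` of tuples in a structure `M` there is a family
`(a'_j)_{j ∈ I'}` in some elementary extension of `M` locally based on `(a_i)_{i ∈ I}`, and
symmetrically. -/
theorem statement_0 (L' : FirstOrder.Language.{u, u}) (I I' : Type u)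
    [L'.Structure I] [L'.Structure I'] (hI : Infinite I) (hI' : Infinite I')
    (hage : L'.age I = L'.age I')
    (L : FirstOrder.Language.{u, u}) (M : Type u) [L.Structure M] (β : Type) :
    (∀ a : I → β → M, ∃ E : ElemExtension L M,
      letI := E.str
      ∃ b : I' → β → E.carrier,
        LocallyBased (L := L) L' b fun i x => E.emb.toFun (a i x)) ∧
    (∀ b : I' → β → M, ∃ E : ElemExtension L M,
      letI := E.str
      ∃ a : I → β → E.carrier,
        LocallyBased (L := L) L' a fun j x => E.emb.toFun (b j x)) := by
  exact ⟨fun a => exists_locallyBased L' I I' hI hage.ge L M β a,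
    fun b => exists_locallyBased L' I' I hI' hage.le L M β b⟩

end PaperTP
end

section
/- In the random graph, the formula φ(x; y,z) := (x R y ∧ ¬ x R z) has the c_2-tree property, with inconsistency witnessed by the quantifier-free type of a pair consisting of a red index below a green index. -/
/- Common definitions for formalizing "Tree properties for colored linear orders". -/

open FirstOrder FirstOrder.Language Cardinal

universe u v

namespace PaperTP

/-- The graph formula `φ(x; y, z) := x R y ∧ ¬ x R z`. -/
def rgFormula : FirstOrder.Language.graph.Formula (Fin 1 ⊕ Fin 2) :=
  (Language.adj.formula₂ (Term.var (Sum.inl 0)) (Term.var (Sum.inr 0))) ⊓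
    ∼(Language.adj.formula₂ (Term.var (Sum.inl 0)) (Term.var (Sum.inr 1)))

theorem rg_realize {V : Type} [FirstOrder.Language.graph.Structure V] (x : Fin 1 → V)
    (y : Fin 2 → V) :
    Formula.Realize rgFormula (Sum.elim x y) ↔
      Structure.RelMap Language.adj ![x 0, y 0] ∧ ¬ Structure.RelMap Language.adj ![x 0, y 1] := by
  unfold rgFormula
  rw [Formula.realize_inf, Formula.realize_not, Formula.realize_rel₂, Formula.realize_rel₂]
  simp

/-- Finite satisfiability of initial segments of a sequence of formulas gives consistency
(by passing to an ultrapower). -/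
theorem consistent_of_fin {L : FirstOrder.Language.{0, 0}} {M : Type} [L.Structure M] [Nonempty M]
    {α β : Type} (φs : ℕ → L.Formula (α ⊕ β)) (as : ℕ → β → M)
    (h : ∀ n, ∃ x : α → M, ∀ i ≤ n, Formula.Realize (φs i) (Sum.elim x (as i))) :
    Consistent φs as := by
  choose x hx using h
  let U : Ultrafilter ℕ := Filter.hyperfilter ℕ
  let N : Type := (U : Filter ℕ).Product (fun _ => M)
  let c : (ℕ → M) → N := fun f => Quotient.mk ((U : Filter ℕ).productSetoid (fun _ => M)) f
  let e : M ↪ₑ[L] N :=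
    { toFun := fun m => c (fun _ => m)
      map_formula' := by
        intro n φ v
        have := Ultraproduct.realize_formula_cast (u := U) (M := fun _ => M) φ
          (fun i (_ : ℕ) => v i)
        simp only [Filter.eventually_const] at this
        exact this }
  refine ⟨⟨N, inferInstance, e⟩, fun a => c (fun n => x n a), fun i => ?_⟩
  have key := (Ultraproduct.realize_formula_cast (u := U) (M := fun _ => M) (φs i)
    (Sum.elim (fun a n => x n a) (fun b _ => as i b))).2 (by
      have hge : ∀ᶠ n in (U : Filter ℕ), i ≤ n :=
        Nat.hyperfilter_le_atTop (Filter.eventually_ge_atTop i)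
      filter_upwards [hge] with n hn
      have := hx n i hn
      convert this using 1
      funext z
      cases z <;> rfl)
  have hz : (Sum.elim (fun a => c (fun n => x n a)) fun j => e.toFun (as i j)) =
      fun z => c (Sum.elim (fun a n => x n a) (fun b _ => as i b) z) := by
    funext z
    cases z <;> rfl
  change Formula.Realize (φs i) (Sum.elim (fun a => c (fun n => x n a)) fun j => e.toFun (as i j))
  rw [hz]
  exact key

/-- In the random graph (a countable graph satisfying the extension axioms), the
formula `φ(x; y, z) := x R y ∧ ¬ x R z` has the `c₂`-tree property, with inconsistency witnessed
by the quantifier-free type of a pair consisting of a red index below a green index. -/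
theorem statement_7 (V : Type) [Countable V] (G : SimpleGraph V)
    (hext : ∀ U W : Finset V, (∀ u ∈ U, u ∉ W) →
      ∃ v : V, v ∉ U ∧ v ∉ W ∧ (∀ u ∈ U, G.Adj v u) ∧ ∀ w ∈ W, ¬ G.Adj v w)
    (C : Type) [(colLang Bool).Structure C] (hC : IsColoredLimit Bool C)
    (j₀ j₁ : C) (hred : HasColor Bool false j₀) (hgreen : HasColor Bool true j₁)
    (hlt : cLT Bool j₀ j₁) :
    letI := G.structure
    HasITPWith (colLang Bool) C (M := V) rgFormula ![j₀, j₁] := by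
  classical
  letI := G.structure
  have hinf : Infinite V := by
    by_contra hf
    rw [not_infinite_iff_finite] at hf
    have := Fintype.ofFinite V
    obtain ⟨v, hv, -⟩ := hext Finset.univ ∅ (by simp)
    exact hv (Finset.mem_univ v)
  let v : ℕ ↪ V := Infinite.natEmbedding V
  let col : List C → Prop := fun η => ∃ c, η.getLast? = some c ∧ HasColor Bool true c
  let e : List C → ℕ := fun η => if col η then 1 else 0
  have he : ∀ η, e η = 0 ∨ e η = 1 := by
    intro η
    by_cases h : col η <;> simp [e, h]
  refine ⟨fun η => ![v (2 * η.length + e η), v (2 * η.length + (1 - e η))], ?_, ?_⟩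
  · intro b
    apply consistent_of_fin
    intro n
    let l : ℕ → List C := fun m => List.ofFn fun i : Fin m => b i
    have hl : ∀ m, (l m).length = m := by simp [l]
    obtain ⟨x, -, -, hU, hW⟩ := hext
      ((Finset.range (n + 1)).image fun m => v (2 * m + e (l m)))
      ((Finset.range (n + 1)).image fun m => v (2 * m + (1 - e (l m)))) (by
        intro u hu hw
        simp only [Finset.mem_image] at hu hw
        obtain ⟨p, -, rfl⟩ := hu
        obtain ⟨q, -, hq⟩ := hw
        have := v.injective hq
        have h1 := he (l p)
        have h2 := he (l q)
        have h3 : q = p := by omega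
        subst h3
        omega)
    refine ⟨fun _ => x, fun i hi => ?_⟩
    rw [rg_realize]
    have hm : i ∈ Finset.range (n + 1) := Finset.mem_range.2 (by omega)
    have h1 := hU _ (Finset.mem_image_of_mem _ hm)
    have h2 := hW _ (Finset.mem_image_of_mem _ hm)
    have hli := hl i
    simp only [l] at h1 h2 hli
    refine ⟨?_, ?_⟩
    · change G.Adj x (v (2 * (List.ofFn fun j : Fin i => b j).length + _))
      rw [hli]; exact h1
    · change ¬ G.Adj x (v (2 * (List.ofFn fun j : Fin i => b j).length + (1 - _)))
      rw [hli]; exact h2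
  · intro η t ht hcon
    have hcol : ∀ (c : Bool) (i : Fin 2), HasColor Bool c (![j₀, j₁] i) ↔ HasColor Bool c (t i) := by
      intro c i
      have := ht ((colSym c).formula₁ (Term.var i)) (BoundedFormula.IsAtomic.rel _ _).isQF
      rw [Formula.realize_rel₁, Formula.realize_rel₁] at this
      exact this
    have h0 : HasColor Bool false (t 0) := (hcol false 0).1 hred
    have h1 : HasColor Bool true (t 1) := (hcol true 1).1 hgreen
    have h0' : ¬ HasColor Bool true (t 0) := fun h =>
      Bool.false_ne_true ((hC.partition (t 0)).unique h0 h)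
    have e0 : e (η ++ [t 0]) = 0 := by simp [e, col, h0']
    have e1 : e (η ++ [t 1]) = 1 := by simp [e, col, h1]
    obtain ⟨E, x, hx⟩ := hcon
    letI := E.str
    have r0 := ((rg_realize _ _).1 (hx 0)).1
    have r1 := ((rg_realize _ _).1 (hx 1)).2
    simp only [e0, e1, List.length_append, List.length_singleton] at r0 r1
    exact r1 r0

end PaperTP
end

section
/- If a formula φ(x,y) has the c_m-tree property, then it has the c_n-tree property for every n > m, with inconsistency witnessed by the same quantifier-free type q. In particular, c_2-TP implies c_κ-TP for every κ ≥ 2. -/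
/- Common definitions for formalizing "Tree properties for colored linear orders". -/

open FirstOrder FirstOrder.Language Cardinal

universe u v

namespace PaperTP

/-- Terms in the colored order language are variables. -/
lemma term_var {κ : Type u} {n : ℕ} (t : (colLang κ).Term (Fin n ⊕ Fin 0)) :
    ∃ j : Fin n, t = Term.var (Sum.inl j) := by
  cases t with
  | var x =>
    rcases x with x | x
    · exact ⟨x, rfl⟩
    · exact x.elim0
  | func f _ => exact PEmpty.elim f

lemma atomic_along {σ τ : Type u} (i : σ → τ) {A B : Type u} [(colLang σ).Structure A]
    [(colLang τ).Structure B] {n : ℕ} (t : Fin n → A) (s : Fin n → B)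
    (heq : ∀ j l, t j = t l ↔ s j = s l)
    (hlt : ∀ j l, cLT σ (t j) (t l) ↔ cLT τ (s j) (s l))
    (hcol : ∀ c j, HasColor σ c (t j) ↔ HasColor τ (i c) (s j)) :
    qfTypeEqAlong (colMap i) t s := by
  intro φ hφ
  unfold LHom.onFormula Formula.Realize
  induction hφ with
  | falsum => exact Iff.rfl
  | imp _ _ ih1 ih2 =>
    simp only [LHom.onBoundedFormula, BoundedFormula.realize_imp, ih1, ih2]
  | of_isAtomic h =>
    cases h with
    | equal t1 t2 =>
      obtain ⟨j, rfl⟩ := term_var t1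
      obtain ⟨l, rfl⟩ := term_var t2
      exact heq j l
    | @rel m R ts =>
      choose js hjs using fun z => term_var (ts z)
      obtain rfl : ts = fun z => Term.var (Sum.inl (js z)) := funext hjs
      match m, R, js with
      | 0, R, _ => exact PEmpty.elim R
      | 1, R, js =>
        have h1 : (fun z => t (js z)) = ![t (js 0)] := by
          ext z; fin_cases z; rfl
        have h2 : (fun z => s (js z)) = ![s (js 0)] := by
          ext z; fin_cases z; rfl
        have := hcol R (js 0)
        unfold HasColor at this
        rw [← h1, ← h2] at this
        exact this
      | 2, R, js =>
        have h1 : (fun z => t (js z)) = ![t (js 0), t (js 1)] := by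
          ext z; fin_cases z <;> rfl
        have h2 : (fun z => s (js z)) = ![s (js 0), s (js 1)] := by
          ext z; fin_cases z <;> rfl
        have := hlt (js 0) (js 1)
        unfold cLT at this
        rw [← h1, ← h2] at this
        exact this
      | (_ + 3), R, _ => exact PEmpty.elim R

lemma colMap_id (κ : Type u) : colMap (id : κ → κ) = LHom.id (colLang κ) := by
  refine LHom.funext ?_ ?_
  · funext n f; exact PEmpty.elim f
  · funext n R
    match n, R with
    | 0, R => exact PEmpty.elim R
    | 1, R => rfl
    | 2, R => rfl
    | (_ + 3), R => exact PEmpty.elim R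

lemma atomic_qf {κ : Type u} {A B : Type u} [(colLang κ).Structure A]
    [(colLang κ).Structure B] {n : ℕ} (t : Fin n → A) (s : Fin n → B)
    (heq : ∀ j l, t j = t l ↔ s j = s l)
    (hlt : ∀ j l, cLT κ (t j) (t l) ↔ cLT κ (s j) (s l))
    (hcol : ∀ c j, HasColor κ c (t j) ↔ HasColor κ c (s j)) :
    qfTypeEq (colLang κ) t s := by
  intro φ hφ
  have := atomic_along id t s heq hlt hcol φ hφ
  rw [colMap_id] at this
  simpa [LHom.onFormula, LHom.id_onBoundedFormula] using this

lemma iso_cLT {κ C : Type u} [(colLang κ).Structure C] (g : C ≃[colLang κ] C) (x y : C) :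
    cLT κ (g x) (g y) ↔ cLT κ x y := by
  unfold cLT
  rw [← g.map_rel (ltSym κ) ![x, y] ]
  apply iff_of_eq; congr 1
  ext z; fin_cases z <;> rfl

lemma iso_color {κ C : Type u} [(colLang κ).Structure C] (g : C ≃[colLang κ] C) (c : κ) (x : C) :
    HasColor κ c (g x) ↔ HasColor κ c x := by
  unfold HasColor
  rw [← g.map_rel (colSym c) ![x] ]
  apply iff_of_eq; congr 1
  ext z; fin_cases z; rfl

section
variable {κ C : Type u} [(colLang κ).Structure C]

lemma color_iff (h : IsColoredLimit κ C) {x y : C} {d : κ} (hx : HasColor κ d x)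
    (hy : HasColor κ d y) (c : κ) : HasColor κ c x ↔ HasColor κ c y := by
  constructor
  · intro hc
    rwa [(h.partition x).unique hc hx]
  · intro hc
    rwa [(h.partition y).unique hc hy]

lemma lim_irrefl (h : IsColoredLimit κ C) (x : C) : ¬ cLT κ x x :=
  haveI := h.strict; irrefl_of (cLT κ) x

lemma lim_trans (h : IsColoredLimit κ C) {x y z : C} (h1 : cLT κ x y) (h2 : cLT κ y z) :
    cLT κ x z :=
  haveI := h.strict; trans_of (cLT κ) h1 h2

lemma lim_tri (h : IsColoredLimit κ C) (x y : C) : cLT κ x y ∨ x = y ∨ cLT κ y x :=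
  haveI := h.strict; trichotomous_of (cLT κ) x y

lemma lim_between (h : IsColoredLimit κ C) (c : κ) (a b : C) (hab : cLT κ a b) :
    ∃ x, HasColor κ c x ∧ cLT κ a x ∧ cLT κ x b := by
  obtain ⟨ca, hca, -⟩ := h.partition a
  obtain ⟨cb, hcb, -⟩ := h.partition b
  obtain ⟨f, hf, hc⟩ := h.ageFull 3 ![ca, c, cb]
  have h02 := hf 0 2 (by decide)
  have hc0 : HasColor κ ca (f 0) := hc 0
  have hc2 : HasColor κ cb (f 2) := hc 2
  obtain ⟨g, hg⟩ := h.ultrahomogeneous 2 ![f 0, f 2] ![a, b] (by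
    have e1 : f 0 ≠ f 2 := fun e => lim_irrefl h (f 2) (by rw [e] at h02; exact h02)
    have e2 : a ≠ b := fun e => lim_irrefl h b (by rw [e] at hab; exact hab)
    have n1 : ¬ cLT κ (f 2) (f 0) := fun e => lim_irrefl h _ (lim_trans h e h02)
    have n2 : ¬ cLT κ b a := fun e => lim_irrefl h _ (lim_trans h e hab)
    apply atomic_qf
    · intro j l; fin_cases j <;> fin_cases l <;> simp [e1, e2, e1.symm, e2.symm]
    · intro j l; fin_cases j <;> fin_cases l <;> simp [h02, hab, n1, n2, lim_irrefl h]
    · intro d j; fin_cases j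
      · exact color_iff h hc0 hca d
      · exact color_iff h hc2 hcb d)
  have g0 : g (f 0) = a := hg 0
  have g1 : g (f 2) = b := hg 1
  refine ⟨g (f 1), (iso_color g c _).2 (hc 1), ?_, ?_⟩
  · rw [← g0]; exact (iso_cLT g _ _).2 (hf 0 1 (by decide))
  · rw [← g1]; exact (iso_cLT g _ _).2 (hf 1 2 (by decide))

lemma lim_ends (h : IsColoredLimit κ C) (c : κ) (a : C) :
    (∃ x, HasColor κ c x ∧ cLT κ x a) ∧ (∃ x, HasColor κ c x ∧ cLT κ a x) := by
  obtain ⟨ca, hca, -⟩ := h.partition a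
  obtain ⟨f, hf, hc⟩ := h.ageFull 3 ![c, ca, c]
  have hc1 : HasColor κ ca (f 1) := hc 1
  obtain ⟨g, hg⟩ := h.ultrahomogeneous 1 (fun _ => f 1) (fun _ => a) (by
    apply atomic_qf
    · intro j l; simp
    · intro j l; simp [lim_irrefl h]
    · intro d j; exact color_iff h hc1 hca d)
  have g0 : g (f 1) = a := hg 0
  refine ⟨⟨g (f 0), (iso_color g c _).2 (hc 0), ?_⟩, ⟨g (f 2), (iso_color g c _).2 (hc 2), ?_⟩⟩
  · rw [← g0]; exact (iso_cLT g _ _).2 (hf 0 1 (by decide))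
  · rw [← g0]; exact (iso_cLT g _ _).2 (hf 1 2 (by decide))

lemma finset_max (h : IsColoredLimit κ C) (S : Finset C) (hS : S.Nonempty) :
    ∃ m ∈ S, ∀ x ∈ S, x = m ∨ cLT κ x m := by
  classical
  induction hS using Finset.Nonempty.cons_induction with
  | singleton a => exact ⟨a, by simp, by simp⟩
  | cons a s ha hs ih =>
    obtain ⟨m, hm, hmax⟩ := ih
    rcases lim_tri h a m with h1 | h1 | h1
    · exact ⟨m, by simp [hm], by
        intro x hx
        rcases Finset.mem_cons.1 hx with rfl | hx
        · exact Or.inr h1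
        · exact hmax x hx⟩
    · exact absurd (h1 ▸ hm) ha
    · refine ⟨a, by simp, ?_⟩
      intro x hx
      rcases Finset.mem_cons.1 hx with rfl | hx
      · exact Or.inl rfl
      · rcases hmax x hx with rfl | h2
        · exact Or.inr h1
        · exact Or.inr (lim_trans h h2 h1)

lemma finset_min (h : IsColoredLimit κ C) (S : Finset C) (hS : S.Nonempty) :
    ∃ m ∈ S, ∀ x ∈ S, x = m ∨ cLT κ m x := by
  classical
  induction hS using Finset.Nonempty.cons_induction with
  | singleton a => exact ⟨a, by simp, by simp⟩
  | cons a s ha hs ih =>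
    obtain ⟨m, hm, hmax⟩ := ih
    rcases lim_tri h m a with h1 | h1 | h1
    · exact ⟨m, by simp [hm], by
        intro x hx
        rcases Finset.mem_cons.1 hx with rfl | hx
        · exact Or.inr h1
        · exact hmax x hx⟩
    · exact absurd (h1 ▸ hm) ha
    · refine ⟨a, by simp, ?_⟩
      intro x hx
      rcases Finset.mem_cons.1 hx with rfl | hx
      · exact Or.inl rfl
      · rcases hmax x hx with rfl | h2
        · exact Or.inr h1
        · exact Or.inr (lim_trans h h1 h2)

lemma lim_extend (h : IsColoredLimit κ C) (c : κ) (S T : Finset C)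
    (hST : ∀ x ∈ S, ∀ y ∈ T, cLT κ x y) :
    ∃ z, HasColor κ c z ∧ (∀ x ∈ S, cLT κ x z) ∧ ∀ y ∈ T, cLT κ z y := by
  rcases S.eq_empty_or_nonempty with rfl | hS <;> rcases T.eq_empty_or_nonempty with rfl | hT
  · obtain ⟨f, -, hc⟩ := h.ageFull 1 ![c]
    exact ⟨f 0, hc 0, by simp, by simp⟩
  · obtain ⟨b, hb, hmin⟩ := finset_min h T hT
    obtain ⟨z, hz, hzb⟩ := (lim_ends h c b).1
    refine ⟨z, hz, by simp, fun y hy => ?_⟩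
    rcases hmin y hy with rfl | h2
    · exact hzb
    · exact lim_trans h hzb h2
  · obtain ⟨a, ha, hmax⟩ := finset_max h S hS
    obtain ⟨z, hz, haz⟩ := (lim_ends h c a).2
    refine ⟨z, hz, fun x hx => ?_, by simp⟩
    rcases hmax x hx with rfl | h2
    · exact haz
    · exact lim_trans h h2 haz
  · obtain ⟨a, ha, hmax⟩ := finset_max h S hS
    obtain ⟨b, hb, hmin⟩ := finset_min h T hT
    obtain ⟨z, hz, haz, hzb⟩ := lim_between h c a b (hST a ha b hb)
    refine ⟨z, hz, fun x hx => ?_, fun y hy => ?_⟩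
    · rcases hmax x hx with rfl | h2
      · exact haz
      · exact lim_trans h h2 haz
    · rcases hmin y hy with rfl | h2
      · exact hzb
      · exact lim_trans h hzb h2

/-- Universality: every countable colored linear order embeds into the colored limit. -/
lemma lim_universal (h : IsColoredLimit κ C) {A : Type u} [Countable A] (r : A → A → Prop)
    (hr : IsStrictTotalOrder A r) (col : A → κ) :
    ∃ F : A → C, (∀ a b, r a b → cLT κ (F a) (F b)) ∧ ∀ a, HasColor κ (col a) (F a) := by
  classical
  rcases isEmpty_or_nonempty A with hA | hA
  · exact ⟨fun a => hA.elim a, fun a => hA.elim a, fun a => hA.elim a⟩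
  obtain ⟨e, he⟩ := exists_surjective_nat A
  have hC : Nonempty C := by
    obtain ⟨f, -, -⟩ := h.ageFull 1 (fun _ => col (e 0))
    exact ⟨f 0⟩
  let Good : (n : ℕ) → ((m : ℕ) → m < n → C) → C → Prop := fun n prev x =>
    HasColor κ (col (e n)) x ∧ ∀ m (hm : m < n),
      (r (e m) (e n) → cLT κ (prev m hm) x) ∧ (r (e n) (e m) → cLT κ x (prev m hm)) ∧
      (e m = e n → prev m hm = x)
  let G : ℕ → C := WellFounded.fix (C := fun _ => C) Nat.lt_wfRel.wf
    (fun n prev => Classical.epsilon (Good n prev))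
  have hG : ∀ n, G n = Classical.epsilon (Good n fun m _ => G m) := fun n =>
    WellFounded.fix_eq (C := fun _ => C) Nat.lt_wfRel.wf _ n
  have key : ∀ n, Good n (fun m _ => G m) (G n) := by
    intro n
    induction n using Nat.strong_induction_on with
    | _ n ih =>
    rw [hG n]
    apply Classical.epsilon_spec (p := Good n fun m _ => G m)
    have mono : ∀ m < n, ∀ l < n, r (e m) (e l) → cLT κ (G m) (G l) := by
      intro m hm l hl hrl
      rcases lt_trichotomy m l with hlt | rfl | hlt
      · exact ((ih l hl).2 m hlt).1 hrl
      · exact absurd hrl (irrefl_of r _)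
      · exact ((ih m hm).2 l hlt).2.1 hrl
    have eqv : ∀ m < n, ∀ l < n, e m = e l → G m = G l := by
      intro m hm l hl hrl
      rcases lt_trichotomy m l with hlt | rfl | hlt
      · exact ((ih l hl).2 m hlt).2.2 hrl
      · rfl
      · exact (((ih m hm).2 l hlt).2.2 hrl.symm).symm
    by_cases hex : ∃ m < n, e m = e n
    · obtain ⟨m, hm, hmn⟩ := hex
      refine ⟨G m, hmn ▸ (ih m hm).1, fun l hl => ⟨fun hrl => ?_, fun hrl => ?_, fun hrl => ?_⟩⟩
      · exact mono l hl m hm (hmn ▸ hrl)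
      · exact mono m hm l hl (hmn ▸ hrl)
      · exact eqv l hl m hm (hrl.trans hmn.symm)
    · push Not at hex
      obtain ⟨z, hz, h1, h2⟩ := lim_extend h (col (e n))
        (((Finset.range n).filter fun m => r (e m) (e n)).image G)
        (((Finset.range n).filter fun m => r (e n) (e m)).image G) (by
          simp only [Finset.mem_image, Finset.mem_filter, Finset.mem_range]
          rintro _ ⟨m, ⟨hm, hmn⟩, rfl⟩ _ ⟨l, ⟨hl, hln⟩, rfl⟩
          exact mono m hm l hl (trans_of r hmn hln))
      refine ⟨z, hz, fun l hl => ⟨fun hrl => ?_, fun hrl => ?_, fun hrl => ?_⟩⟩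
      · exact h1 _ (Finset.mem_image_of_mem _ (by simp [hl, hrl]))
      · exact h2 _ (Finset.mem_image_of_mem _ (by simp [hl, hrl]))
      · exact absurd hrl (hex l hl)
  choose ν hν using he
  refine ⟨fun a => G (ν a), fun a b hab => ?_, fun a => ?_⟩
  · rcases lt_trichotomy (ν a) (ν b) with hlt | heq | hlt
    · exact ((key (ν b)).2 _ hlt).1 (by rwa [hν, hν])
    · have : a = b := by rw [← hν a, heq, hν]
      exact absurd (this ▸ hab) (irrefl_of r b)
    · exact ((key (ν a)).2 _ hlt).2.1 (by rwa [hν, hν])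
  · have := (key (ν a)).1
    rwa [hν] at this

end

section
variable {κ C κ' C' : Type u} [(colLang κ).Structure C] [(colLang κ').Structure C']

lemma mono_iff (h : IsColoredLimit κ C) (h' : IsColoredLimit κ' C') (F : C → C')
    (hF : ∀ a b, cLT κ a b → cLT κ' (F a) (F b)) (a b : C) :
    (a = b ↔ F a = F b) ∧ (cLT κ a b ↔ cLT κ' (F a) (F b)) := by
  rcases lim_tri h a b with h1 | rfl | h1
  · have h2 := hF _ _ h1
    refine ⟨⟨fun e => by rw [e], fun e => ?_⟩, fun _ => h2, fun _ => h1⟩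
    rw [e] at h2; exact absurd h2 (lim_irrefl h' _)
  · simp [lim_irrefl h, lim_irrefl h']
  · have h2 := hF _ _ h1
    refine ⟨⟨fun e => by rw [e], fun e => ?_⟩, fun h3 => hF _ _ h3, fun h3 => ?_⟩
    · rw [e] at h2; exact absurd h2 (lim_irrefl h' _)
    · exact absurd (lim_trans h' h2 h3) (lim_irrefl h' _)

end

/-- If a formula has the `c_m`-tree property, then it has the `c_n`-tree property
for every `n > m` (colors mapped along an injective, non-surjective map), with inconsistency
witnessed by the same quantifier-free type `q`. -/
theorem statement_8 (L : FirstOrder.Language.{u, u}) (M : Type u) [L.Structure M]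
    (σ τ : Type u) [Nontrivial σ] (i : σ → τ) (hinj : Function.Injective i)
    (hns : ¬ Function.Surjective i)
    (Cσ Cτ : Type u) [(colLang σ).Structure Cσ] [(colLang τ).Structure Cτ]
    (hσ : IsColoredLimit σ Cσ) (hτ : IsColoredLimit τ Cτ)
    {mx my k : ℕ} (φ : L.Formula (Fin mx ⊕ Fin my)) (q : Fin k → Cσ)
    (h : HasITPWith (colLang σ) Cσ (M := M) φ q) :
    ∃ q' : Fin k → Cτ, qfTypeEqAlong (colMap i) q q' ∧
      HasITPWith (colLang τ) Cτ (M := M) φ q' := by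
  classical
  have := hσ.countable
  have := hτ.countable
  choose colσ hcolσ hcolσ' using hσ.partition
  choose colτ hcolτ hcolτ' using hτ.partition
  obtain ⟨H, hHlt, hHcol⟩ := lim_universal hτ (cLT σ) hσ.strict (fun x => i (colσ x))
  obtain ⟨F, hFlt, hFcol⟩ := lim_universal hσ (cLT τ) hτ.strict
    (fun x => Function.invFun i (colτ x))
  have hHi := mono_iff hσ hτ H hHlt
  obtain ⟨a, hbr, hinc⟩ := h
  refine ⟨fun j => H (q j), ?_, fun η => a (η.map F), ?_, ?_⟩
  · apply atomic_along
    · intro j l; exact (hHi _ _).1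
    · intro j l; exact (hHi _ _).2
    · intro c j
      constructor
      · intro hc
        rw [hcolσ' _ _ hc]; exact hHcol _
      · intro hc
        have := hinj ((hτ.partition _).unique hc (hHcol _))
        rw [this]; exact hcolσ _
  · intro b
    have := hbr (fun n => F (b n))
    simpa [List.map_ofFn, Function.comp_def] using this
  · intro η t ht
    obtain ⟨g, hg⟩ := hτ.ultrahomogeneous k _ t ht
    have hK := mono_iff hσ hσ (fun x => F (g (H x)))
      (fun x y hxy => hFlt _ _ ((iso_cLT g _ _).2 (hHlt _ _ hxy)))
    have := hinc (η.map F) (fun j => F (t j)) (by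
      simp only [← hg]
      apply atomic_qf
      · intro j l; exact (hK _ _).1
      · intro j l; exact (hK _ _).2
      · intro c j
        refine color_iff hσ (hcolσ (q j)) ?_ c
        have h1 := hFcol (g (H (q j)))
        have h2 : colτ (g (H (q j))) = i (colσ (q j)) :=
          (hcolτ' _ _ ((iso_color g _ _).2 (hHcol (q j)))).symm
        simp only [h2, Function.leftInverse_invFun hinj (colσ (q j))] at h1
        exact h1)
    simpa using this

end PaperTP
end
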